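/- Let c > 1/4, ε > 0, a ∈ ℝ, and let B, 𝒳 : [2, ∞) → ℝ be continuous and bounded. Then there exist ρ₀ ≥ 2, E₀ ∈ (0, 1) and C > 0 such that for every E ∈ (0, E₀) and every μ ≥ 0, every nontrivial solution u of u'' = q u on (ρ₀, ∞), where q(ρ) = E + μ e^(−2ρ) (1 + e^(−ρ) B(ρ)) − c ρ⁻² + a ρ⁻² (log ρ)^(−ε) + e^(−ρ) 𝒳(ρ), has at most C · log(1/E) zeros in (ρ₀, ∞); that is, the set {ρ > ρ₀ : u(ρ) = 0} is finite with cardinality at most C · log(1/E). -/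

import Mathlib

open Set

/-- A solution of `u'' = q u` with a double zero vanishes on the whole half-line. -/
lemma eq_zero_of_double_zero {q u u' : ℝ → ℝ} {r x : ℝ} (hq : ContinuousOn q (Ioi r))
    (hu : ∀ t ∈ Ioi r, HasDerivAt u (u' t) t)
    (hu' : ∀ t ∈ Ioi r, HasDerivAt u' (q t * u t) t)
    (hx : x ∈ Ioi r) (h0 : u x = 0) (h1 : u' x = 0) : ∀ y ∈ Ioi r, u y = 0 := by
  intro y hy
  have hsub : uIcc x y ⊆ Ioi r := fun t ht => lt_of_lt_of_le (lt_min hx hy) ht.1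
  obtain ⟨L, hL⟩ := isCompact_uIcc.exists_bound_of_continuousOn (hq.mono hsub)
  simp only [Real.norm_eq_abs] at hL
  have hG : ∀ k : ℝ, ∀ t ∈ uIcc x y,
      HasDerivAt (fun s => (u s ^ 2 + u' s ^ 2) * Real.exp (k * s))
        ((2 * (1 + q t) * (u t * u' t) + k * (u t ^ 2 + u' t ^ 2)) * Real.exp (k * t)) t := by
    intro k t ht
    have := (((hu t (hsub ht)).pow 2).add ((hu' t (hsub ht)).pow 2)).mul
      (((hasDerivAt_id t).const_mul k).exp)
    refine this.congr_deriv ?_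
    simp
    ring
  have hbound : ∀ t ∈ uIcc x y,
      |2 * (1 + q t) * (u t * u' t)| ≤ (1 + L) * (u t ^ 2 + u' t ^ 2) := by
    intro t ht
    have h2 : |1 + q t| ≤ 1 + L := (abs_add_le _ _).trans (by simpa using hL t ht)
    have h3 : |2 * (u t * u' t)| ≤ u t ^ 2 + u' t ^ 2 := by
      rw [abs_le]
      constructor <;> nlinarith [sq_nonneg (u t + u' t), sq_nonneg (u t - u' t)]
    calc |2 * (1 + q t) * (u t * u' t)| = |1 + q t| * |2 * (u t * u' t)| := by
          rw [← abs_mul]; ring_nf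
      _ ≤ _ := mul_le_mul h2 h3 (abs_nonneg _) ((abs_nonneg _).trans h2)
  have key : (u y ^ 2 + u' y ^ 2) ≤ 0 := by
    rcases le_total x y with hxy | hxy
    · rw [uIcc_of_le hxy] at hG hbound
      have hanti := antitoneOn_of_deriv_nonpos (convex_Icc x y)
        (fun t ht => (hG (-(1 + L)) t ht).continuousAt.continuousWithinAt)
        (fun t ht => (hG (-(1 + L)) t (interior_subset ht)).differentiableAt.differentiableWithinAt)
        (fun t ht => by
          rw [(hG _ t (interior_subset ht)).deriv]
          have := (abs_le.1 (hbound t (interior_subset ht))).2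
          exact mul_nonpos_of_nonpos_of_nonneg (by linarith) (Real.exp_pos _).le)
      have := hanti (left_mem_Icc.2 hxy) (right_mem_Icc.2 hxy) hxy
      simp only [h0, h1] at this
      exact nonpos_of_mul_nonpos_left (by simpa using this) (Real.exp_pos _)
    · rw [uIcc_of_ge hxy] at hG hbound
      have hmono := monotoneOn_of_deriv_nonneg (convex_Icc y x)
        (fun t ht => (hG (1 + L) t ht).continuousAt.continuousWithinAt)
        (fun t ht => (hG (1 + L) t (interior_subset ht)).differentiableAt.differentiableWithinAt)
        (fun t ht => by
          rw [(hG _ t (interior_subset ht)).deriv]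
          have := (abs_le.1 (hbound t (interior_subset ht))).1
          exact mul_nonneg (by linarith) (Real.exp_pos _).le)
      have := hmono (left_mem_Icc.2 hxy) (right_mem_Icc.2 hxy) hxy
      simp only [h0, h1] at this
      exact nonpos_of_mul_nonpos_left (by simpa using this) (Real.exp_pos _)
  nlinarith [sq_nonneg (u' y), sq_nonneg (u y)]

/-- If the Riccati inequality `φ' + φ ^ 2 ≤ q` has a solution on `[x, y]`, then a solution of
`u'' = q u` vanishing at both `x` and `y` has a double zero at `x`. -/
lemma deriv_eq_zero_of_riccati {q u u' φ φ' : ℝ → ℝ} {x y : ℝ} (hxy : x < y)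
    (hu : ∀ t ∈ Icc x y, HasDerivAt u (u' t) t)
    (hu' : ∀ t ∈ Icc x y, HasDerivAt u' (q t * u t) t)
    (hφ : ∀ t ∈ Icc x y, HasDerivAt φ (φ' t) t)
    (hq : ∀ t ∈ Icc x y, φ' t + φ t ^ 2 ≤ q t)
    (hx : u x = 0) (hy : u y = 0) : u' x = 0 := by
  have hF : ∀ t ∈ Icc x y, HasDerivAt (fun s => u s * u' s - φ s * u s ^ 2)
      ((u' t - φ t * u t) ^ 2 + (q t - (φ' t + φ t ^ 2)) * u t ^ 2) t := by
    intro t ht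
    refine (((hu t ht).mul (hu' t ht)).sub ((hφ t ht).mul ((hu t ht).pow 2))).congr_deriv ?_
    simp
    ring
  have hmono := monotoneOn_of_deriv_nonneg (convex_Icc x y)
    (fun t ht => (hF t ht).continuousAt.continuousWithinAt)
    (fun t ht => (hF t (interior_subset ht)).differentiableAt.differentiableWithinAt)
    (fun t ht => by
      rw [(hF t (interior_subset ht)).deriv]
      have := hq t (interior_subset ht)
      exact add_nonneg (sq_nonneg _) (mul_nonneg (by linarith) (sq_nonneg _)))
  have hzero : ∀ t ∈ Icc x y, u t * u' t - φ t * u t ^ 2 = 0 := by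
    intro t ht
    have h1 := hmono (left_mem_Icc.2 hxy.le) ht ht.1
    have h2 := hmono ht (right_mem_Icc.2 hxy.le) ht.2
    simp only [hx, hy] at h1 h2
    linarith
  have hxm := left_mem_Icc.2 hxy.le
  have hd := ((hF x hxm).hasDerivWithinAt (s := Icc x y)).congr
    (f₁ := fun _ => (0 : ℝ)) (fun t ht => (hzero t ht).symm) (hzero x hxm).symm
  have := (uniqueDiffOn_Icc hxy x hxm).eq_deriv _ hd (hasDerivWithinAt_const x _ (0 : ℝ))
  simpa [hx] using this

/-- A set of reals `≥ 1` that grows geometrically with ratio `l` and whose nonmaximal elements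
are below `T` has logarithmically many elements. -/
lemma finite_and_ncard_le_of_geometric {S : Set ℝ} {l T : ℝ} (hl : 1 < l) (hT : 1 ≤ T)
    (hS : ∀ x ∈ S, 1 ≤ x) (hgrow : ∀ x ∈ S, ∀ y ∈ S, x < y → l * x < y ∧ x < T) :
    S.Finite ∧ (S.ncard : ℝ) ≤ Real.log T / Real.log l + 2 := by
  have hlog : 0 < Real.log l := Real.log_pos hl
  have hlT : 0 ≤ Real.log T := Real.log_nonneg hT
  set g : ℝ → ℕ := fun x => ⌊min (Real.log x) (Real.log T + Real.log l) / Real.log l⌋₊ with hg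
  have hlt : ∀ x ∈ S, ∀ y ∈ S, x < y → g x < g y := by
    intro x hx y hy hxy
    obtain ⟨h1, h2⟩ := hgrow x hx y hy hxy
    have hx0 : 0 < x := one_pos.trans_le (hS x hx)
    have h3 : Real.log x + Real.log l ≤ Real.log y := by
      rw [add_comm, ← Real.log_mul (by positivity) hx0.ne']
      exact Real.log_le_log (by positivity) h1.le
    have h4 : Real.log x ≤ Real.log T := Real.log_le_log hx0 h2.le
    have h5 : 0 ≤ Real.log x := Real.log_nonneg (hS x hx)
    have h6 : min (Real.log x) (Real.log T + Real.log l) = Real.log x := min_eq_left (by linarith)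
    have h7 : Real.log x + Real.log l ≤ min (Real.log y) (Real.log T + Real.log l) :=
      le_min h3 (by linarith)
    rw [Nat.lt_iff_add_one_le]
    simp only [hg, h6]
    rw [← Nat.floor_add_one (by positivity)]
    apply Nat.floor_le_floor
    rw [div_add_one hlog.ne']
    gcongr
  have hinj : InjOn g S := by
    intro x hx y hy hxy
    rcases lt_trichotomy x y with h | h | h
    · exact absurd hxy (hlt x hx y hy h).ne
    · exact h
    · exact absurd hxy (hlt y hy x hx h).ne'
  have hmaps : MapsTo g S (Iio (⌊Real.log T / Real.log l⌋₊ + 2)) := by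
    intro x _
    rw [mem_Iio, show ⌊Real.log T / Real.log l⌋₊ + 2 = ⌊Real.log T / Real.log l⌋₊ + 1 + 1 from rfl,
      Nat.lt_succ_iff, ← Nat.floor_add_one (by positivity), div_add_one hlog.ne']
    apply Nat.floor_le_floor
    gcongr
    exact min_le_right _ _
  refine ⟨Finite.of_injOn hmaps hinj (finite_Iio _), ?_⟩
  have hcard := ncard_le_ncard_of_injOn g hmaps hinj (finite_Iio _)
  rw [ncard_eq_toFinset_card' (Iio _), toFinset_Iio, Nat.card_Iio] at hcard
  calc (S.ncard : ℝ) ≤ ((⌊Real.log T / Real.log l⌋₊ + 2 : ℕ) : ℝ) := by exact_mod_cast hcard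
    _ ≤ _ := by
      push_cast
      gcongr
      exact Nat.floor_le (by positivity)

/-- Two zeros of a nontrivial solution of `u'' = q u` with `q ≥ E - K / t ^ 2` are separated
geometrically, and only the last one can lie beyond `K / E`. -/
lemma zeros_separated {q u u' : ℝ → ℝ} {r E K : ℝ} (hr : 0 ≤ r) (hK : 1 ≤ K) (hE : E ∈ Ioo 0 1)
    (hqc : ContinuousOn q (Ioi r)) (hq : ∀ t ∈ Ioi r, E - K / t ^ 2 ≤ q t)
    (hu : ∀ t ∈ Ioi r, HasDerivAt u (u' t) t)
    (hu' : ∀ t ∈ Ioi r, HasDerivAt u' (q t * u t) t)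
    (hne : ∃ t ∈ Ioi r, u t ≠ 0) {x y : ℝ} (hx : x ∈ Ioi r) (hux : u x = 0) (huy : u y = 0)
    (hxy : x < y) : (1 + 1 / (2 * K)) * x < y ∧ x < K / E := by
  obtain ⟨hE0, hE1⟩ := hE
  have hx0 : 0 < x := lt_of_le_of_lt hr hx
  have hsub : Icc x y ⊆ Ioi r := fun t ht => lt_of_lt_of_le hx ht.1
  have hu'x : u' x ≠ 0 := by
    intro h
    obtain ⟨t, ht, htne⟩ := hne
    exact htne (eq_zero_of_double_zero hqc hu hu' hx hux h t ht)
  constructor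
  · by_contra! hle
    refine hu'x (deriv_eq_zero_of_riccati (φ := fun t => -(2 * K / x ^ 2) * (t - x))
      (φ' := fun _ => -(2 * K / x ^ 2)) hxy (fun t ht => hu t (hsub ht))
      (fun t ht => hu' t (hsub ht)) (fun t _ => ?_) (fun t ht => ?_) hux huy)
    · simpa using ((hasDerivAt_id t).sub_const x).const_mul (-(2 * K / x ^ 2))
    · refine le_trans ?_ (hq t (hsub ht))
      have h1 : K / t ^ 2 ≤ K / x ^ 2 := by
        have := ht.1
        gcongr
      have h2 : 2 * K / x ^ 2 * (t - x) ≤ 1 / x := by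
        have : t - x ≤ x / (2 * K) := by
          have : (1 + 1 / (2 * K)) * x = x + x / (2 * K) := by ring
          linarith [ht.2]
        calc 2 * K / x ^ 2 * (t - x) ≤ 2 * K / x ^ 2 * (x / (2 * K)) := by gcongr
          _ = 1 / x := by field_simp
      have h3 : 0 ≤ 2 * K / x ^ 2 * (t - x) :=
        mul_nonneg (by positivity) (sub_nonneg.2 ht.1)
      have h4 : (-(2 * K / x ^ 2) * (t - x)) ^ 2 ≤ K / x ^ 2 := by
        calc (-(2 * K / x ^ 2) * (t - x)) ^ 2 = (2 * K / x ^ 2 * (t - x)) ^ 2 := by ring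
          _ ≤ (1 / x) ^ 2 := by gcongr
          _ = 1 / x ^ 2 := by ring
          _ ≤ K / x ^ 2 := by gcongr
      have h5 : 2 * K / x ^ 2 = 2 * (K / x ^ 2) := by ring
      linarith
  · by_contra! hle
    refine hu'x (deriv_eq_zero_of_riccati (φ := fun _ => 0) (φ' := fun _ => 0) hxy
      (fun t ht => hu t (hsub ht)) (fun t ht => hu' t (hsub ht))
      (fun t _ => hasDerivAt_const t 0) (fun t ht => ?_) hux huy)
    refine le_trans ?_ (hq t (hsub ht))
    have ht0 : 0 < t := hx0.trans_le ht.1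
    have h1 : K ≤ t * E := (div_le_iff₀ hE0).1 (hle.trans ht.1)
    have h2 : 1 ≤ t := by nlinarith
    have h3 : K / t ^ 2 ≤ E := by
      rw [div_le_iff₀ (by positivity)]
      nlinarith [mul_nonneg hE0.le ht0.le]
    simpa using h3

/-- The potential is bounded below by `E - K / t ^ 2`, with `K` independent of `E` and `μ`. -/
lemma potential_lower_bound {c ε a E μ t b X M N : ℝ} (hε : 0 < ε) (hμ : 0 ≤ μ)
    (ht : 3 ≤ t) (hMt : M ≤ t) (hb : |b| ≤ M) (hX : |X| ≤ N) :
    E - (|c| + |a| + 2 * N + 1) / t ^ 2 ≤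
      E + μ * Real.exp (-2 * t) * (1 + Real.exp (-t) * b) - c * (t ^ 2)⁻¹
        + a * (t ^ 2)⁻¹ * Real.log t ^ (-ε) + Real.exp (-t) * X := by
  have hs : 0 < (t ^ 2)⁻¹ := by positivity
  have h1 : 0 ≤ μ * Real.exp (-2 * t) * (1 + Real.exp (-t) * b) := by
    have h2 : Real.exp (-t) * |b| ≤ 1 := by
      rw [Real.exp_neg, inv_mul_le_iff₀ (Real.exp_pos _)]
      linarith [Real.add_one_le_exp t]
    have h3 : -(Real.exp (-t) * |b|) ≤ Real.exp (-t) * b := by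
      rw [← mul_neg]
      exact mul_le_mul_of_nonneg_left (neg_abs_le b) (Real.exp_pos _).le
    have : 0 ≤ 1 + Real.exp (-t) * b := by linarith
    positivity
  have h4 : -(|a| * (t ^ 2)⁻¹) ≤ a * (t ^ 2)⁻¹ * Real.log t ^ (-ε) := by
    have hlog : 1 ≤ Real.log t := by
      rw [Real.le_log_iff_exp_le (by linarith)]
      linarith [Real.exp_one_lt_d9]
    have hle : Real.log t ^ (-ε) ≤ 1 := Real.rpow_le_one_of_one_le_of_nonpos hlog (by linarith)
    have hnn : 0 ≤ Real.log t ^ (-ε) := Real.rpow_nonneg (by linarith) _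
    have : |a * (t ^ 2)⁻¹ * Real.log t ^ (-ε)| ≤ |a| * (t ^ 2)⁻¹ := by
      rw [abs_mul, abs_mul, abs_of_pos hs, abs_of_nonneg hnn]
      exact mul_le_of_le_one_right (by positivity) hle
    exact (abs_le.1 this).1
  have h5 : -(2 * N * (t ^ 2)⁻¹) ≤ Real.exp (-t) * X := by
    have he : Real.exp (-t) ≤ 2 * (t ^ 2)⁻¹ := by
      rw [Real.exp_neg, inv_le_comm₀ (Real.exp_pos _) (by positivity), mul_inv, inv_inv]
      linarith [Real.quadratic_le_exp_of_nonneg (show 0 ≤ t by linarith)]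
    have : |Real.exp (-t) * X| ≤ 2 * (t ^ 2)⁻¹ * N := by
      rw [abs_mul, Real.abs_exp]
      exact mul_le_mul he hX (abs_nonneg _) (by positivity)
    linarith [(abs_le.1 this).1]
  have h6 : c * (t ^ 2)⁻¹ ≤ |c| * (t ^ 2)⁻¹ := mul_le_mul_of_nonneg_right (le_abs_self c) hs.le
  rw [div_eq_mul_inv]
  linarith

/-- For c > 1/4, ε > 0, a ∈ ℝ and B, 𝒳 continuous bounded on [2, ∞), there
exist ρ₀ ≥ 2, E₀ ∈ (0, 1) and C > 0 such that for all E ∈ (0, E₀) and μ ≥ 0, every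
nontrivial solution u of u'' = q u on (ρ₀, ∞), with
q(ρ) = E + μ e^(−2ρ)(1 + e^(−ρ)B(ρ)) − c ρ⁻² + a ρ⁻² (log ρ)^(−ε) + e^(−ρ)𝒳(ρ),
has at most C·log(1/E) zeros in (ρ₀, ∞). -/
theorem stmt_19 (c ε a : ℝ) (hc : 1/4 < c) (hε : 0 < ε)
    (B 𝒳 : ℝ → ℝ)
    (hB : ContinuousOn B (Ici 2)) (hBbd : ∃ M, ∀ ρ ∈ Ici (2:ℝ), |B ρ| ≤ M)
    (h𝒳 : ContinuousOn 𝒳 (Ici 2)) (h𝒳bd : ∃ M, ∀ ρ ∈ Ici (2:ℝ), |𝒳 ρ| ≤ M) :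
    ∃ ρ₀ : ℝ, 2 ≤ ρ₀ ∧ ∃ E₀ ∈ Ioo (0:ℝ) 1, ∃ C > (0:ℝ),
      ∀ E ∈ Ioo (0:ℝ) E₀, ∀ μ ≥ (0:ℝ), ∀ u u' : ℝ → ℝ,
        (∀ ρ ∈ Ioi ρ₀, HasDerivAt u (u' ρ) ρ) →
        (∀ ρ ∈ Ioi ρ₀, HasDerivAt u'
          ((E + μ * Real.exp (-2 * ρ) * (1 + Real.exp (-ρ) * B ρ)
              - c * (ρ ^ 2)⁻¹ + a * (ρ ^ 2)⁻¹ * Real.log ρ ^ (-ε)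
              + Real.exp (-ρ) * 𝒳 ρ) * u ρ) ρ) →
        (∃ ρ ∈ Ioi ρ₀, u ρ ≠ 0) →
        {ρ ∈ Ioi ρ₀ | u ρ = 0}.Finite ∧
          ({ρ ∈ Ioi ρ₀ | u ρ = 0}.ncard : ℝ) ≤ C * Real.log (1 / E) := by
  obtain ⟨M, hM⟩ := hBbd
  obtain ⟨N, hN⟩ := h𝒳bd
  have hN0 : 0 ≤ N := (abs_nonneg _).trans (hN 2 self_mem_Ici)
  set K : ℝ := |c| + |a| + 2 * N + 1 with hKdef
  have hK : 1 ≤ K := by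
    have := abs_nonneg c
    have := abs_nonneg a
    linarith
  have hl : 1 < 1 + 1 / (2 * K) := by
    have : 0 < 1 / (2 * K) := by positivity
    linarith
  have hlog : 0 < Real.log (1 + 1 / (2 * K)) := Real.log_pos hl
  have hlogK : 0 ≤ Real.log K := Real.log_nonneg hK
  have hr3 : 3 ≤ max 3 M := le_max_left _ _
  refine ⟨max 3 M, by linarith, Real.exp (-1), ⟨Real.exp_pos _, by simp⟩,
    (Real.log K + 1) / Real.log (1 + 1 / (2 * K)) + 2, by positivity, ?_⟩
  intro E hE μ hμ u u' hu hu' hne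
  have hE1 : E < 1 := hE.2.trans (by simp)
  have hE0 : 0 < E := hE.1
  have hgt : ∀ t ∈ Ioi (max 3 M), 3 < t ∧ M < t := fun t ht => max_lt_iff.1 ht
  have hIci : Ioi (max 3 M) ⊆ Ici 2 := fun t ht => by
    have := (hgt t ht).1
    exact mem_Ici.2 (by linarith)
  have hqc : ContinuousOn (fun ρ => E + μ * Real.exp (-2 * ρ) * (1 + Real.exp (-ρ) * B ρ)
      - c * (ρ ^ 2)⁻¹ + a * (ρ ^ 2)⁻¹ * Real.log ρ ^ (-ε)
      + Real.exp (-ρ) * 𝒳 ρ) (Ioi (max 3 M)) := by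
    have hB' := hB.mono hIci
    have h𝒳' := h𝒳.mono hIci
    have hpos : ∀ t ∈ Ioi (max 3 M), t ≠ 0 := fun t ht => by
      have := (hgt t ht).1
      linarith
    have hinv : ContinuousOn (fun ρ : ℝ => (ρ ^ 2)⁻¹) (Ioi (max 3 M)) :=
      (continuousOn_id.pow 2).inv₀ fun t ht => pow_ne_zero 2 (hpos t ht)
    have hpow : ContinuousOn (fun ρ : ℝ => Real.log ρ ^ (-ε)) (Ioi (max 3 M)) :=
      (continuousOn_id.log hpos).rpow_const fun t ht => Or.inl (Real.log_pos (by
        have := (hgt t ht).1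
        simp only [id]
        linarith)).ne'
    fun_prop
  have hsep := finite_and_ncard_le_of_geometric (S := {ρ ∈ Ioi (max 3 M) | u ρ = 0})
    (T := K / E) hl ((one_le_div hE0).2 (by linarith))
    (fun x hx => by linarith [(hgt x hx.1).1])
    (fun x hx y hy hxy => zeros_separated (by linarith) hK ⟨hE0, hE1⟩ hqc
      (fun t ht => potential_lower_bound hε hμ (hgt t ht).1.le (hgt t ht).2.le
        (hM t (hIci ht)) (hN t (hIci ht))) hu hu' hne hx.1 hx.2 hy.2 hxy)
  refine ⟨hsep.1, hsep.2.trans ?_⟩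
  have hlogE : 1 ≤ Real.log (1 / E) := by
    rw [one_div, Real.log_inv]
    have := (Real.log_lt_iff_lt_exp hE0).2 hE.2
    linarith
  rw [div_eq_mul_one_div K E, Real.log_mul (by positivity) (by positivity), add_mul,
    div_mul_eq_mul_div]
  gcongr
  · nlinarith
  · linarith
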